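/- Let Ω ⊂ ℝⁿ (n ≥ 2) be a bounded open set, let 1 < p < ∞, and let M > 0. There is a constant C = C(n, p, Ω, M) with the following property. Let σ₀, σ₁ : Ω → ℝ be measurable with 1/M ≤ σⱼ ≤ M a.e., and let A₀, A₁ : Ω → (n×n real matrices) be measurable with Aⱼ(x) symmetric and (1/M)|ξ|² ≤ Aⱼ(x)ξ·ξ ≤ M|ξ|² for a.e. x ∈ Ω and all ξ ∈ ℝⁿ. If u₀, u₁ ∈ C¹(closure Ω) are weak solutions of div(σⱼ|Aⱼ∇uⱼ·∇uⱼ|^{(p−2)/2}Aⱼ∇uⱼ) = 0 in Ω (j = 0, 1) with u₁ = u₀ on ∂Ω, then ∫_Ω (|∇u₁| + |∇u₀|)^{p−2}·|∇u₁ − ∇u₀|² dx ≤ C·(‖σ₁ − σ₀‖_{L^∞(Ω)} + ‖A₁ − A₀‖_{L^∞(Ω)})·‖∇u₀‖_{L^p(Ω)}^{p−1}·‖∇u₁ − ∇u₀‖_{L^p(Ω)}, where the integrand is interpreted as 0 at points where ∇u₁ = ∇u₀ = 0. -/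

import Mathlib

open MeasureTheory Real
open scoped RealInnerProductSpace

/-- The linear action of an `n × n` real matrix on Euclidean space, as a
continuous linear map. -/
noncomputable def matCLM {n : ℕ} (M : Matrix (Fin n) (Fin n) ℝ) :
    EuclideanSpace ℝ (Fin n) →L[ℝ] EuclideanSpace ℝ (Fin n) :=
  LinearMap.toContinuousLinearMap (Matrix.toEuclideanLin M)

/-- `u` is a weak solution of `div(σ |A∇u·∇u|^((p-2)/2) A∇u) = 0` in `Ω`,
tested against `C¹(closure Ω)` functions vanishing on `∂Ω`. -/
def IsWeakSolution {n : ℕ} (Ω : Set (EuclideanSpace ℝ (Fin n))) (p : ℝ)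
    (σ : EuclideanSpace ℝ (Fin n) → ℝ)
    (A : EuclideanSpace ℝ (Fin n) → Matrix (Fin n) (Fin n) ℝ)
    (u : EuclideanSpace ℝ (Fin n) → ℝ) : Prop :=
  ∀ φ : EuclideanSpace ℝ (Fin n) → ℝ, ContDiffOn ℝ 1 φ (closure Ω) →
    (∀ x ∈ frontier Ω, φ x = 0) →
    ∫ x in Ω, σ x * |⟪matCLM (A x) (gradient u x), gradient u x⟫| ^ ((p - 2) / 2)
      * ⟪matCLM (A x) (gradient u x), gradient φ x⟫ = 0

/-- The `p`-Dirichlet energy `E_{σ,A}(v) = ∫_Ω σ |A∇v·∇v|^(p/2) dx`. -/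
noncomputable def energy {n : ℕ} (Ω : Set (EuclideanSpace ℝ (Fin n))) (p : ℝ)
    (σ : EuclideanSpace ℝ (Fin n) → ℝ)
    (A : EuclideanSpace ℝ (Fin n) → Matrix (Fin n) (Fin n) ℝ)
    (v : EuclideanSpace ℝ (Fin n) → ℝ) : ℝ :=
  ∫ x in Ω, σ x * |⟪matCLM (A x) (gradient v x), gradient v x⟫| ^ (p / 2)

/-- The `L^p(Ω)` norm of a vector field. -/
noncomputable def lpNormVF {n : ℕ} (Ω : Set (EuclideanSpace ℝ (Fin n))) (p : ℝ)
    (g : EuclideanSpace ℝ (Fin n) → EuclideanSpace ℝ (Fin n)) : ℝ :=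
  (∫ x in Ω, ‖g x‖ ^ p) ^ (1 / p)

/-- The `L^∞(Ω)` norm (essential supremum) of a scalar function. -/
noncomputable def linftyNorm {n : ℕ} (Ω : Set (EuclideanSpace ℝ (Fin n)))
    (f : EuclideanSpace ℝ (Fin n) → ℝ) : ℝ :=
  essSup (fun x => |f x|) (volume.restrict Ω)

/-- The `L^∞(Ω)` norm (essential supremum of the operator norm) of a
matrix-valued function. -/
noncomputable def linftyNormMat {n : ℕ} (Ω : Set (EuclideanSpace ℝ (Fin n)))
    (A : EuclideanSpace ℝ (Fin n) → Matrix (Fin n) (Fin n) ℝ) : ℝ :=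
  essSup (fun x => ‖matCLM (A x)‖) (volume.restrict Ω)

theorem exists_mul_rpow_le_rpow_sub_rpow {q : ℝ} (hq : 0 < q) :
    ∃ k : ℝ, 0 < k ∧ ∀ a b : ℝ, 0 ≤ b → b ≤ a →
      k * ((a + b) ^ (q - 1) * (a - b)) ≤ a ^ q - b ^ q := by
  rcases le_total 1 q with h1 | h1
  · refine ⟨(2 ^ (q - 1))⁻¹, by positivity, fun a b hb hab => ?_⟩
    rcases hab.eq_or_lt with rfl | hlt
    · simp
    have ha : 0 < a := hb.trans_lt hlt
    have hs : (2 ^ (q - 1))⁻¹ * (a + b) ^ (q - 1) ≤ a ^ (q - 1) := by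
      rw [inv_mul_le_iff₀ (by positivity), ← mul_rpow (by norm_num) ha.le]
      exact rpow_le_rpow (by positivity) (by linarith) (by linarith)
    have hsplit : ∀ t : ℝ, 0 ≤ t → t ^ q = t ^ (q - 1) * t := fun t ht => by
      rw [← rpow_add_one' ht (by linarith)]; simp
    have hmono : b ^ (q - 1) ≤ a ^ (q - 1) := rpow_le_rpow hb hab (by linarith)
    rw [hsplit a ha.le, hsplit b hb]
    nlinarith [mul_le_mul_of_nonneg_right hs (sub_nonneg.2 hab),
      mul_le_mul_of_nonneg_right hmono hb]
  · refine ⟨q, hq, fun a b hb hab => ?_⟩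
    rcases hab.eq_or_lt with rfl | hlt
    · simp
    have ha : 0 < a := hb.trans_lt hlt
    have hs : (a + b) ^ (q - 1) ≤ a ^ (q - 1) :=
      rpow_le_rpow_of_nonpos ha (by linarith) (by linarith)
    have hbern := rpow_one_add_le_one_add_mul_self (s := b / a - 1)
      (by linarith [div_nonneg hb ha.le]) hq.le h1
    rw [add_sub_cancel, div_rpow hb ha.le, div_le_iff₀ (by positivity)] at hbern
    have haq : a ^ q = a ^ (q - 1) * a := by
      rw [← rpow_add_one ha.ne']; simp
    have hcalc : (1 + q * (b / a - 1)) * a ^ q = a ^ q - q * (a ^ (q - 1) * (a - b)) := by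
      rw [haq]; field_simp; ring
    rw [hcalc] at hbern
    have := mul_le_mul_of_nonneg_left (mul_le_mul_of_nonneg_right hs (sub_nonneg.2 hab)) hq.le
    linarith

theorem exists_mul_le_rpow_monotone {p : ℝ} (hp : 1 < p) :
    ∃ k : ℝ, 0 < k ∧ ∀ a b c : ℝ, 0 ≤ a → 0 ≤ b → |c| ≤ a * b →
      k * ((a + b) ^ (p - 2) * (a ^ 2 + b ^ 2 - 2 * c)) ≤
        a ^ (p - 2) * (a ^ 2 - c) + b ^ (p - 2) * (b ^ 2 - c) := by
  obtain ⟨k, hk, hkab⟩ := exists_mul_rpow_le_rpow_sub_rpow (q := p - 1) (by linarith)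
  refine ⟨min k (2 ^ (p - 1))⁻¹, by positivity, fun a b c ha hb hc => ?_⟩
  wlog hab : b ≤ a generalizing a b
  · have := this b a hb ha (by rwa [mul_comm]) (le_of_not_ge hab)
    rw [add_comm b a, add_comm (b ^ 2)] at this
    linarith
  set m := min k (2 ^ (p - 1))⁻¹
  have hsplit : ∀ t : ℝ, 0 ≤ t → t ^ (p - 1) = t ^ (p - 2) * t := fun t ht => by
    rw [← rpow_add_one' ht (by linarith)]; ring_nf
  have hpos : m * ((a + b) ^ (p - 2) * (a - b) ^ 2) ≤
      (a ^ (p - 1) - b ^ (p - 1)) * (a - b) := by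
    have h := hkab a b hb hab
    rw [show p - 1 - 1 = p - 2 by ring] at h
    have h' := mul_le_mul_of_nonneg_right h (sub_nonneg.2 hab)
    have h'' : m * ((a + b) ^ (p - 2) * (a - b) ^ 2) ≤ k * ((a + b) ^ (p - 2) * (a - b) ^ 2) :=
      mul_le_mul_of_nonneg_right (min_le_left _ _) (by positivity)
    linarith
  have hneg : m * ((a + b) ^ (p - 2) * (a + b) ^ 2) ≤
      (a ^ (p - 1) + b ^ (p - 1)) * (a + b) := by
    have h : (2 ^ (p - 1))⁻¹ * (a + b) ^ (p - 1) ≤ a ^ (p - 1) := by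
      rw [inv_mul_le_iff₀ (by positivity), ← mul_rpow (by norm_num) ha]
      exact rpow_le_rpow (by positivity) (by linarith) (by linarith)
    have h' : m * (a + b) ^ (p - 1) ≤ (2 ^ (p - 1))⁻¹ * (a + b) ^ (p - 1) :=
      mul_le_mul_of_nonneg_right (min_le_right _ _) (by positivity)
    have hb' : 0 ≤ b ^ (p - 1) := by positivity
    have h2 := mul_le_mul_of_nonneg_right (h'.trans (h.trans (le_add_of_nonneg_right hb')))
      (add_nonneg ha hb)
    rw [hsplit (a + b) (by positivity)] at h2
    linarith
  rw [hsplit a ha, hsplit b hb] at hpos hneg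
  obtain ⟨hc1, hc2⟩ := abs_le.1 hc
  rcases (mul_nonneg ha hb).eq_or_lt with h0 | h0
  · have hc0 : c = a * b := by linarith
    rw [hc0]
    linarith
  · refine le_of_mul_le_mul_left ?_ (mul_pos two_pos h0)
    have e1 := mul_le_mul_of_nonneg_left hpos (by linarith : 0 ≤ a * b + c)
    have e2 := mul_le_mul_of_nonneg_left hneg (by linarith : 0 ≤ a * b - c)
    linarith

theorem exists_mul_rpow_le_rpow_of_comparable (r : ℝ) {m : ℝ} (hm : 0 < m) :
    ∃ k : ℝ, 0 < k ∧ ∀ s t : ℝ, 0 ≤ s → 0 ≤ t → s ≤ m * t → t ≤ m * s →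
      k * s ^ r ≤ t ^ r := by
  rcases le_total 0 r with hr | hr
  · refine ⟨(m ^ r)⁻¹, by positivity, fun s t hs ht hst _ => ?_⟩
    rw [inv_mul_le_iff₀ (by positivity), ← mul_rpow hm.le ht]
    exact rpow_le_rpow hs hst hr
  · refine ⟨m ^ r, by positivity, fun s t hs ht hst hts => ?_⟩
    rw [← mul_rpow hm.le hs]
    rcases ht.eq_or_lt with rfl | ht'
    · have : s = 0 := by linarith
      simp [this]
    · exact rpow_le_rpow_of_nonpos ht' hts hr

section Form

variable {E : Type*} [NormedAddCommGroup E] [InnerProductSpace ℝ E]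

/-- `T` is symmetric and its quadratic form lies between `‖ξ‖² / M` and `M ‖ξ‖²`. -/
structure IsEllipticForm (M : ℝ) (T : E →L[ℝ] E) : Prop where
  symm : ∀ ξ η : E, ⟪T ξ, η⟫ = ⟪T η, ξ⟫
  lower : ∀ ξ : E, 1 / M * ‖ξ‖ ^ 2 ≤ ⟪T ξ, ξ⟫
  upper : ∀ ξ : E, ⟪T ξ, ξ⟫ ≤ M * ‖ξ‖ ^ 2

namespace IsEllipticForm

variable {M : ℝ} {T : E →L[ℝ] E}

theorem nonneg (hM : 0 < M) (h : IsEllipticForm M T) (ξ : E) : 0 ≤ ⟪T ξ, ξ⟫ :=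
  le_trans (by positivity) (h.lower ξ)

theorem abs_inner_le_sqrt_mul_sqrt (hM : 0 < M) (h : IsEllipticForm M T) (ξ η : E) :
    |⟪T ξ, η⟫| ≤ √⟪T ξ, ξ⟫ * √⟪T η, η⟫ := by
  have hd := discrim_le_zero (a := ⟪T η, η⟫) (b := 2 * ⟪T ξ, η⟫) (c := ⟪T ξ, ξ⟫) fun t => by
    have := h.nonneg hM (ξ + t • η)
    simp only [map_add, map_smul, inner_add_left, inner_add_right, real_inner_smul_left,
      real_inner_smul_right, h.symm η ξ] at this
    linarith
  rw [discrim] at hd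
  rw [← sqrt_mul (h.nonneg hM ξ)]
  exact abs_le_sqrt (by linarith)

theorem abs_inner_le (hM : 0 < M) (h : IsEllipticForm M T) (ξ η : E) :
    |⟪T ξ, η⟫| ≤ M * (‖ξ‖ * ‖η‖) := by
  refine (h.abs_inner_le_sqrt_mul_sqrt hM ξ η).trans ?_
  rw [← sqrt_mul (h.nonneg hM ξ), sqrt_le_left (by positivity)]
  calc ⟪T ξ, ξ⟫ * ⟪T η, η⟫ ≤ (M * ‖ξ‖ ^ 2) * (M * ‖η‖ ^ 2) :=
        mul_le_mul (h.upper ξ) (h.upper η) (h.nonneg hM η) (by positivity)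
    _ = _ := by ring

theorem norm_le_sqrt_mul_sqrt (hM : 0 < M) (h : IsEllipticForm M T) (ξ : E) :
    ‖ξ‖ ≤ √M * √⟪T ξ, ξ⟫ := by
  rw [← sqrt_mul hM.le]
  refine le_sqrt_of_sq_le ?_
  have := mul_le_mul_of_nonneg_left (h.lower ξ) hM.le
  rwa [← mul_assoc, mul_one_div_cancel hM.ne', one_mul] at this

theorem sqrt_le_sqrt_mul_norm (hM : 0 < M) (h : IsEllipticForm M T) (ξ : E) :
    √⟪T ξ, ξ⟫ ≤ √M * ‖ξ‖ := by
  rw [sqrt_le_left (by positivity), mul_pow, sq_sqrt hM.le]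
  exact h.upper ξ

theorem abs_rpow_eq (hM : 0 < M) (h : IsEllipticForm M T) (p : ℝ) (ξ : E) :
    |⟪T ξ, ξ⟫| ^ ((p - 2) / 2) = √⟪T ξ, ξ⟫ ^ (p - 2) := by
  rw [abs_of_nonneg (h.nonneg hM ξ), sqrt_eq_rpow, ← rpow_mul (h.nonneg hM ξ)]
  ring_nf

end IsEllipticForm

theorem exists_flux_strongly_monotone (E : Type*) [NormedAddCommGroup E] [InnerProductSpace ℝ E]
    {p M : ℝ} (hp : 1 < p) (hM : 0 < M) :
    ∃ c : ℝ, 0 < c ∧ ∀ T : E →L[ℝ] E, IsEllipticForm M T → ∀ ξ η : E,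
      c * ((‖ξ‖ + ‖η‖) ^ (p - 2) * ‖ξ - η‖ ^ 2) ≤
        |⟪T ξ, ξ⟫| ^ ((p - 2) / 2) * ⟪T ξ, ξ - η⟫
          - |⟪T η, η⟫| ^ ((p - 2) / 2) * ⟪T η, ξ - η⟫ := by
  obtain ⟨k, hk, hkab⟩ := exists_mul_le_rpow_monotone hp
  obtain ⟨l, hl, hlst⟩ := exists_mul_rpow_le_rpow_of_comparable (p - 2) (sqrt_pos.2 hM)
  refine ⟨k * l * (1 / M), by positivity, fun T hT ξ η => ?_⟩
  rw [hT.abs_rpow_eq hM, hT.abs_rpow_eq hM]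
  have h := hkab _ _ _ (sqrt_nonneg ⟪T ξ, ξ⟫) (sqrt_nonneg ⟪T η, η⟫)
    (hT.abs_inner_le_sqrt_mul_sqrt hM ξ η)
  have hcomp := hlst (‖ξ‖ + ‖η‖) (√⟪T ξ, ξ⟫ + √⟪T η, η⟫) (by positivity) (by positivity)
    (by linarith [hT.norm_le_sqrt_mul_sqrt hM ξ, hT.norm_le_sqrt_mul_sqrt hM η])
    (by linarith [hT.sqrt_le_sqrt_mul_norm hM ξ, hT.sqrt_le_sqrt_mul_norm hM η])
  rw [sq_sqrt (hT.nonneg hM ξ), sq_sqrt (hT.nonneg hM η)] at h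
  have hdiff : ⟪T ξ, ξ⟫ + ⟪T η, η⟫ - 2 * ⟪T ξ, η⟫ = ⟪T (ξ - η), ξ - η⟫ := by
    simp only [map_sub, inner_sub_left, inner_sub_right, hT.symm η ξ]
    ring
  rw [hdiff] at h
  calc k * l * (1 / M) * ((‖ξ‖ + ‖η‖) ^ (p - 2) * ‖ξ - η‖ ^ 2)
      = k * ((l * (‖ξ‖ + ‖η‖) ^ (p - 2)) * (1 / M * ‖ξ - η‖ ^ 2)) := by ring
    _ ≤ k * ((√⟪T ξ, ξ⟫ + √⟪T η, η⟫) ^ (p - 2) * ⟪T (ξ - η), ξ - η⟫) := by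
        gcongr
        exact hT.lower _
    _ ≤ _ := h
    _ = _ := by
        rw [inner_sub_right, inner_sub_right, hT.symm η ξ]
        ring

theorem exists_rpow_bound_lipschitz (r : ℝ) {M : ℝ} (hM : 0 < M) :
    ∃ B : ℝ, 0 ≤ B ∧ (∀ t ∈ Set.Icc (1 / M) M, t ^ r ≤ B) ∧
      ∀ s ∈ Set.Icc (1 / M) M, ∀ t ∈ Set.Icc (1 / M) M, |s ^ r - t ^ r| ≤ B * |s - t| := by
  have hpos : ∀ t ∈ Set.Icc (1 / M) M, t ≠ 0 := fun t ht =>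
    ((one_div_pos.2 hM).trans_le ht.1).ne'
  have hcont : ∀ q : ℝ, ContinuousOn (fun t : ℝ => t ^ q) (Set.Icc (1 / M) M) := fun q =>
    continuousOn_id.rpow_const fun t ht => Or.inl (hpos t ht)
  obtain ⟨B₁, hB₁⟩ := isCompact_Icc.exists_bound_of_continuousOn (hcont r)
  obtain ⟨B₂, hB₂⟩ := isCompact_Icc.exists_bound_of_continuousOn
    (continuousOn_const.mul (hcont (r - 1)) : ContinuousOn (fun t : ℝ => r * t ^ (r - 1)) _)
  refine ⟨max 0 (max B₁ B₂), le_max_left _ _, fun t ht => ?_, fun s hs t ht => ?_⟩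
  · exact (le_abs_self _).trans ((hB₁ t ht).trans ((le_max_left _ _).trans (le_max_right _ _)))
  · exact (convex_Icc _ _).norm_image_sub_le_of_norm_hasDerivWithin_le
      (f := fun t : ℝ => t ^ r) (f' := fun t => r * t ^ (r - 1))
      (fun t ht => (hasDerivAt_rpow_const (Or.inl (hpos t ht))).hasDerivWithinAt)
      (fun t ht => (hB₂ t ht).trans ((le_max_right _ _).trans (le_max_right _ _))) ht hs

theorem exists_flux_bounds (E : Type*) [NormedAddCommGroup E] [InnerProductSpace ℝ E]
    {p M : ℝ} (hM : 0 < M) :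
    ∃ K : ℝ, 0 < K ∧ ∀ (s₀ s₁ : ℝ) (T₀ T₁ : E →L[ℝ] E), |s₀| ≤ M → |s₁| ≤ M →
      IsEllipticForm M T₀ → IsEllipticForm M T₁ → ∀ ξ ζ : E,
        |s₀ * |⟪T₀ ξ, ξ⟫| ^ ((p - 2) / 2) * ⟪T₀ ξ, ζ⟫| ≤ K * (‖ξ‖ ^ (p - 1) * ‖ζ‖) ∧
        s₀ * |⟪T₀ ξ, ξ⟫| ^ ((p - 2) / 2) * ⟪T₀ ξ, ζ⟫
          - s₁ * |⟪T₁ ξ, ξ⟫| ^ ((p - 2) / 2) * ⟪T₁ ξ, ζ⟫ ≤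
          K * (|s₁ - s₀| + ‖T₁ - T₀‖) * (‖ξ‖ ^ (p - 1) * ‖ζ‖) := by
  obtain ⟨B, hB, hbound, hlip⟩ := exists_rpow_bound_lipschitz ((p - 2) / 2) hM
  refine ⟨M * B * M + B * M + M * B + 1, by positivity,
    fun s₀ s₁ T₀ T₁ hs₀ hs₁ hT₀ hT₁ ξ ζ => ?_⟩
  rcases eq_or_ne ξ 0 with rfl | hξ
  · simp only [map_zero, inner_zero_left, mul_zero, abs_zero, sub_zero]
    constructor <;> positivity
  have hn : 0 < ‖ξ‖ := norm_pos_iff.2 hξ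
  set N := ‖ξ‖ ^ (p - 2) with hN
  have hNpos : 0 < N := by positivity
  have hsplit : ‖ξ‖ ^ (p - 1) = N * ‖ξ‖ := by
    rw [hN, ← rpow_add_one hn.ne']; ring_nf
  have hscale : ∀ T : E →L[ℝ] E, IsEllipticForm M T → ⟪T ξ, ξ⟫ / ‖ξ‖ ^ 2 ∈ Set.Icc (1 / M) M ∧
      |⟪T ξ, ξ⟫| ^ ((p - 2) / 2) = N * (⟪T ξ, ξ⟫ / ‖ξ‖ ^ 2) ^ ((p - 2) / 2) := by
    intro T hT
    refine ⟨⟨(le_div_iff₀ (by positivity)).2 (hT.lower ξ),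
      (div_le_iff₀ (by positivity)).2 (hT.upper ξ)⟩, ?_⟩
    have hpow : N = (‖ξ‖ ^ 2) ^ ((p - 2) / 2) := by
      rw [← rpow_natCast, ← rpow_mul hn.le, hN]
      congr 1
      push_cast
      ring
    rw [abs_of_nonneg (hT.nonneg hM ξ), hpow, ← mul_rpow (by positivity)
      (div_nonneg (hT.nonneg hM ξ) (by positivity)), mul_div_cancel₀ _ (by positivity)]
  obtain ⟨hm₀, he₀⟩ := hscale T₀ hT₀
  obtain ⟨hm₁, he₁⟩ := hscale T₁ hT₁
  rw [he₀, he₁, hsplit]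
  have hd : |⟪T₀ ξ, ξ⟫ / ‖ξ‖ ^ 2 - ⟪T₁ ξ, ξ⟫ / ‖ξ‖ ^ 2| ≤ ‖T₁ - T₀‖ := by
    rw [← sub_div, ← inner_sub_left, abs_div, abs_of_pos (by positivity : 0 < ‖ξ‖ ^ 2),
      div_le_iff₀ (by positivity), ← sub_apply, norm_sub_rev]
    refine (abs_real_inner_le_norm _ _).trans ?_
    rw [sq, ← mul_assoc]
    gcongr
    exact ContinuousLinearMap.le_opNorm _ _
  have hl := (hlip _ hm₀ _ hm₁).trans (mul_le_mul_of_nonneg_left hd hB)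
  have hb₀ := hbound _ hm₀
  have hb₁ := hbound _ hm₁
  have hp₀ : 0 ≤ (⟪T₀ ξ, ξ⟫ / ‖ξ‖ ^ 2) ^ ((p - 2) / 2) :=
    rpow_nonneg (div_nonneg (hT₀.nonneg hM ξ) (by positivity)) _
  have hp₁ : 0 ≤ (⟪T₁ ξ, ξ⟫ / ‖ξ‖ ^ 2) ^ ((p - 2) / 2) :=
    rpow_nonneg (div_nonneg (hT₁.nonneg hM ξ) (by positivity)) _
  set t₀ := (⟪T₀ ξ, ξ⟫ / ‖ξ‖ ^ 2) ^ ((p - 2) / 2)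
  set t₁ := (⟪T₁ ξ, ξ⟫ / ‖ξ‖ ^ 2) ^ ((p - 2) / 2)
  have hi := hT₀.abs_inner_le hM ξ ζ
  have hdi : |⟪T₀ ξ, ζ⟫ - ⟪T₁ ξ, ζ⟫| ≤ ‖T₁ - T₀‖ * (‖ξ‖ * ‖ζ‖) := by
    rw [← inner_sub_left, ← sub_apply, norm_sub_rev, ← mul_assoc]
    refine (abs_real_inner_le_norm _ _).trans ?_
    gcongr
    exact ContinuousLinearMap.le_opNorm _ _
  set i₀ := ⟪T₀ ξ, ζ⟫
  set i₁ := ⟪T₁ ξ, ζ⟫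
  set D := ‖T₁ - T₀‖
  have hD : 0 ≤ D := norm_nonneg _
  set R := ‖ξ‖ * ‖ζ‖ with hR
  have hRn : 0 ≤ R := by positivity
  constructor
  · calc |s₀ * (N * t₀) * i₀| = |s₀| * (N * t₀) * |i₀| := by
          rw [abs_mul, abs_mul, abs_of_nonneg (mul_nonneg hNpos.le hp₀)]
      _ ≤ M * (N * B) * (M * R) := by gcongr
      _ ≤ _ := by
          have : 0 ≤ (B * M + M * B + 1) * (N * R) := by positivity
          rw [hR] at this ⊢
          linarith
  · have e₁ : |(s₀ - s₁) * (N * t₀) * i₀| ≤ |s₁ - s₀| * (N * B) * (M * R) := by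
      rw [abs_mul, abs_mul, abs_of_nonneg (mul_nonneg hNpos.le hp₀), abs_sub_comm]
      gcongr
    have e₂ : |s₁ * (N * (t₀ - t₁)) * i₀| ≤ M * (N * (B * D)) * (M * R) := by
      rw [abs_mul, abs_mul, abs_mul, abs_of_pos hNpos]
      gcongr
    have e₃ : |s₁ * (N * t₁) * (i₀ - i₁)| ≤ M * (N * B) * (D * R) := by
      rw [abs_mul, abs_mul, abs_of_nonneg (mul_nonneg hNpos.le hp₁)]
      gcongr
    have hS := abs_nonneg (s₁ - s₀)
    set S := |s₁ - s₀|
    calc s₀ * (N * t₀) * i₀ - s₁ * (N * t₁) * i₁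
        = (s₀ - s₁) * (N * t₀) * i₀ + s₁ * (N * (t₀ - t₁)) * i₀
          + s₁ * (N * t₁) * (i₀ - i₁) := by ring
      _ ≤ S * (N * B) * (M * R) + M * (N * (B * D)) * (M * R) + M * (N * B) * (D * R) :=
          add_le_add (add_le_add ((le_abs_self _).trans e₁) ((le_abs_self _).trans e₂))
            ((le_abs_self _).trans e₃)
      _ ≤ _ := by
          have : 0 ≤ ((M * B * M + M * B + 1) * S + (B * M + 1) * D) * (N * R) := by positivity
          rw [hR] at this ⊢
          linarith

end Form

theorem IsEllipticForm.norm_le {E : Type*} [NormedAddCommGroup E] [InnerProductSpace ℝ E] {M : ℝ}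
    {T : E →L[ℝ] E} (hM : 0 < M) (h : IsEllipticForm M T) : ‖T‖ ≤ M := by
  refine T.opNorm_le_bound hM.le fun ξ => ?_
  rcases eq_or_ne (T ξ) 0 with h0 | h0
  · rw [h0, norm_zero]
    positivity
  · refine le_of_mul_le_mul_right ?_ (norm_pos_iff.2 h0)
    have := h.abs_inner_le hM ξ (T ξ)
    rw [real_inner_self_eq_norm_mul_norm, abs_of_nonneg (by positivity)] at this
    linarith

theorem ContDiffOn.exists_norm_gradient_le {F : Type*} [NormedAddCommGroup F]
    [InnerProductSpace ℝ F] [CompleteSpace F] [ProperSpace F] {Ω : Set F} (hΩ : IsOpen Ω)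
    (hb : Bornology.IsBounded Ω) {u : F → ℝ} (hu : ContDiffOn ℝ 1 u (closure Ω)) :
    ∃ B : ℝ, 0 ≤ B ∧ ∀ x ∈ Ω, ‖gradient u x‖ ≤ B := by
  have hloc : ∀ x ∈ closure Ω, ∃ t ∈ nhdsWithin x (closure Ω),
      ∃ B : ℝ, ∀ y ∈ t ∩ Ω, ‖gradient u y‖ ≤ B := by
    intro x hx
    obtain ⟨v, hv, -, -, f', hf', hcont⟩ :=
      (contDiffWithinAt_succ_iff_hasFDerivWithinAt' (n := 0) (by simp)).1 (by simpa using hu x hx)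
    rw [Set.insert_eq_of_mem hx] at hv
    have hbd := hcont.continuousWithinAt.norm.eventually_lt_const (lt_add_one ‖f' x‖)
    refine ⟨_, Filter.inter_mem hv hbd, ‖f' x‖ + 1, ?_⟩
    rintro y ⟨⟨hyv, hyb⟩, hyΩ⟩
    have hd : HasFDerivAt u (f' y) y := (hf' y hyv).hasFDerivAt
      (Filter.mem_of_superset (hΩ.mem_nhds hyΩ) subset_closure)
    rw [gradient, LinearIsometryEquiv.norm_map, hd.fderiv]
    exact le_of_lt hyb
  have hcompact : IsCompact (closure Ω) := hb.isCompact_closure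
  obtain ⟨B, hB⟩ : ∃ B : ℝ, ∀ y ∈ closure Ω ∩ Ω, ‖gradient u y‖ ≤ B := by
    refine hcompact.induction_on (p := fun t => ∃ B : ℝ, ∀ y ∈ t ∩ Ω, ‖gradient u y‖ ≤ B)
      ⟨0, by simp⟩ ?_ ?_ hloc
    · rintro s t hst ⟨B, hB⟩
      exact ⟨B, fun y hy => hB y ⟨hst hy.1, hy.2⟩⟩
    · rintro s t ⟨B, hB⟩ ⟨B', hB'⟩
      refine ⟨max B B', ?_⟩
      rintro y ⟨hy | hy, hyΩ⟩
      · exact (hB y ⟨hy, hyΩ⟩).trans (le_max_left _ _)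
      · exact (hB' y ⟨hy, hyΩ⟩).trans (le_max_right _ _)
  exact ⟨max B 0, le_max_right _ _, fun x hx =>
    (hB x ⟨subset_closure hx, hx⟩).trans (le_max_left _ _)⟩

theorem measurable_gradient {F : Type*} [NormedAddCommGroup F] [InnerProductSpace ℝ F]
    [CompleteSpace F] [MeasurableSpace F] [BorelSpace F] (u : F → ℝ) :
    Measurable (gradient u) :=
  (InnerProductSpace.toDual ℝ F).symm.continuous.measurable.comp (measurable_fderiv ℝ u)

theorem inner_matCLM_eq_sum {n : ℕ} (A : Matrix (Fin n) (Fin n) ℝ)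
    (ξ η : EuclideanSpace ℝ (Fin n)) :
    ⟪matCLM A ξ, η⟫ = ∑ i, ∑ j, A i j * ξ j * η i := by
  simp [matCLM, PiLp.inner_apply, Matrix.toLpLin_apply, Matrix.mulVec, dotProduct,
    Finset.mul_sum, mul_comm]

theorem inner_matCLM_comm {n : ℕ} {A : Matrix (Fin n) (Fin n) ℝ} (hA : A.IsSymm)
    (ξ η : EuclideanSpace ℝ (Fin n)) : ⟪matCLM A ξ, η⟫ = ⟪matCLM A η, ξ⟫ := by
  rw [inner_matCLM_eq_sum, inner_matCLM_eq_sum, Finset.sum_comm]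
  refine Finset.sum_congr rfl fun i _ => Finset.sum_congr rfl fun j _ => ?_
  rw [hA.apply i j]
  ring

theorem matCLM_sub {n : ℕ} (A B : Matrix (Fin n) (Fin n) ℝ) :
    matCLM (A - B) = matCLM A - matCLM B := by
  simp [matCLM]

theorem measurable_inner_matCLM {n : ℕ} {A : EuclideanSpace ℝ (Fin n) → Matrix (Fin n) (Fin n) ℝ}
    (hA : ∀ i j : Fin n, Measurable fun x => A x i j)
    {g h : EuclideanSpace ℝ (Fin n) → EuclideanSpace ℝ (Fin n)}
    (hg : Measurable g) (hh : Measurable h) :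
    Measurable fun x => ⟪matCLM (A x) (g x), h x⟫ := by
  simp only [inner_matCLM_eq_sum]
  refine Finset.measurable_sum _ fun i _ => Finset.measurable_sum _ fun j _ => ?_
  exact ((hA i j).mul (by fun_prop)).mul (by fun_prop)

theorem integral_rpow_mul_le_lpNormVF {n : ℕ} {Ω : Set (EuclideanSpace ℝ (Fin n))}
    (hΩ : volume Ω ≠ ⊤) {p : ℝ} (hp : 1 < p)
    {g w : EuclideanSpace ℝ (Fin n) → EuclideanSpace ℝ (Fin n)}
    (hg : Measurable g) (hw : Measurable w) {B : ℝ}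
    (hgB : ∀ᵐ x ∂volume.restrict Ω, ‖g x‖ ≤ B) (hwB : ∀ᵐ x ∂volume.restrict Ω, ‖w x‖ ≤ B) :
    Integrable (fun x => ‖g x‖ ^ (p - 1) * ‖w x‖) (volume.restrict Ω) ∧
    ∫ x in Ω, ‖g x‖ ^ (p - 1) * ‖w x‖ ≤ lpNormVF Ω p g ^ (p - 1) * lpNormVF Ω p w := by
  have : IsFiniteMeasure (volume.restrict Ω) := ⟨by simpa using hΩ.lt_top⟩
  have hconj : (p / (p - 1)).HolderConjugate p :=
    (HolderConjugate.conjExponent hp).symm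
  have hgp : ∀ᵐ x ∂volume.restrict Ω, ‖‖g x‖ ^ (p - 1)‖ ≤ B ^ (p - 1) := by
    filter_upwards [hgB] with x hx
    rw [norm_of_nonneg (by positivity)]
    exact rpow_le_rpow (norm_nonneg _) hx (by linarith)
  have hgm : Measurable fun x => ‖g x‖ ^ (p - 1) := hg.norm.pow_const _
  have hgL : ∀ q, MemLp (fun x => ‖g x‖ ^ (p - 1)) q (volume.restrict Ω) := fun q =>
    MemLp.of_bound hgm.aestronglyMeasurable _ hgp
  have hwL : ∀ q, MemLp (fun x => ‖w x‖) q (volume.restrict Ω) := fun q =>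
    MemLp.of_bound hw.norm.aestronglyMeasurable B (by simpa using hwB)
  refine ⟨(hgL 2).integrable_mul (hwL 2), ?_⟩
  refine (integral_mul_le_Lp_mul_Lq_of_nonneg hconj (ae_of_all _ fun x => by positivity)
    (ae_of_all _ fun x => norm_nonneg _) (hgL _) (hwL _)).trans_eq ?_
  have hp0 : p - 1 ≠ 0 := by linarith
  have hpow : ∀ x, (‖g x‖ ^ (p - 1)) ^ (p / (p - 1)) = ‖g x‖ ^ p := fun x => by
    rw [← rpow_mul (norm_nonneg _), mul_div_cancel₀ _ hp0]
  simp only [hpow, lpNormVF]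
  rw [← rpow_mul (integral_nonneg fun x => by positivity)]
  congr 2
  field_simp

theorem ae_le_essSup_of_ae_le {α : Type*} [MeasurableSpace α] {μ : Measure α} {f : α → ℝ} {B : ℝ}
    (hf : ∀ᵐ x ∂μ, f x ≤ B) : ∀ᵐ x ∂μ, f x ≤ essSup f μ :=
  ae_le_essSup (Filter.isBoundedUnder_of_eventually_le hf)

theorem essSup_nonneg_of_nonneg {α : Type*} [MeasurableSpace α] (μ : Measure α) {f : α → ℝ}
    (hf : ∀ x, 0 ≤ f x) : 0 ≤ essSup f μ := by
  rw [essSup, Filter.limsup_eq]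
  rcases eq_or_ne μ 0 with rfl | hμ
  · simp
  · have : (ae μ).NeBot := ae_neBot.2 hμ
    refine Real.sInf_nonneg fun a ha => ?_
    obtain ⟨x, hx⟩ := Filter.Eventually.exists (Set.mem_ofPred_eq ▸ ha)
    exact (hf x).trans hx

/-- **Estimate (2.5) in the proof of Lemma 3.2**: the strong monotonicity
quantity `I = ∫ (|∇u₁|+|∇u₀|)^{p−2} |∇u₁−∇u₀|² dx` satisfies
`I ≤ C (‖σ₁ − σ₀‖_∞ + ‖A₁ − A₀‖_∞) ‖∇u₀‖_{L^p}^{p−1} ‖∇u₁−∇u₀‖_{L^p}`. -/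
theorem monotonicity_quantity_estimate
    {n : ℕ} (hn : 2 ≤ n) (Ω : Set (EuclideanSpace ℝ (Fin n)))
    (hΩopen : IsOpen Ω) (hΩbdd : Bornology.IsBounded Ω)
    (p : ℝ) (hp1 : 1 < p) (M : ℝ) (hM : 0 < M) :
    ∃ C : ℝ, 0 < C ∧
      ∀ (σ₀ σ₁ : EuclideanSpace ℝ (Fin n) → ℝ)
        (A₀ A₁ : EuclideanSpace ℝ (Fin n) → Matrix (Fin n) (Fin n) ℝ),
        Measurable σ₀ → Measurable σ₁ →
        (∀ i j : Fin n, Measurable fun x => A₀ x i j) →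
        (∀ i j : Fin n, Measurable fun x => A₁ x i j) →
        (∀ᵐ x ∂(volume.restrict Ω), 1 / M ≤ σ₀ x ∧ σ₀ x ≤ M) →
        (∀ᵐ x ∂(volume.restrict Ω), 1 / M ≤ σ₁ x ∧ σ₁ x ≤ M) →
        (∀ᵐ x ∂(volume.restrict Ω), (A₀ x).IsSymm ∧
          ∀ ξ : EuclideanSpace ℝ (Fin n),
            (1 / M) * ‖ξ‖ ^ 2 ≤ ⟪matCLM (A₀ x) ξ, ξ⟫ ∧
            ⟪matCLM (A₀ x) ξ, ξ⟫ ≤ M * ‖ξ‖ ^ 2) →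
        (∀ᵐ x ∂(volume.restrict Ω), (A₁ x).IsSymm ∧
          ∀ ξ : EuclideanSpace ℝ (Fin n),
            (1 / M) * ‖ξ‖ ^ 2 ≤ ⟪matCLM (A₁ x) ξ, ξ⟫ ∧
            ⟪matCLM (A₁ x) ξ, ξ⟫ ≤ M * ‖ξ‖ ^ 2) →
        ∀ u₀ u₁ : EuclideanSpace ℝ (Fin n) → ℝ,
          ContDiffOn ℝ 1 u₀ (closure Ω) → ContDiffOn ℝ 1 u₁ (closure Ω) →
          IsWeakSolution Ω p σ₀ A₀ u₀ → IsWeakSolution Ω p σ₁ A₁ u₁ →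
          (∀ x ∈ frontier Ω, u₁ x = u₀ x) →
          ∫ x in Ω, (‖gradient u₁ x‖ + ‖gradient u₀ x‖) ^ (p - 2)
              * ‖gradient u₁ x - gradient u₀ x‖ ^ 2 ≤
            C * (linftyNorm Ω (fun x => σ₁ x - σ₀ x)
                  + linftyNormMat Ω (fun x => A₁ x - A₀ x))
              * lpNormVF Ω p (fun x => gradient u₀ x) ^ (p - 1)
              * lpNormVF Ω p (fun x => gradient u₁ x - gradient u₀ x) := by
  obtain ⟨c, hc, hmono⟩ := exists_flux_strongly_monotone (EuclideanSpace ℝ (Fin n)) hp1 hM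
  obtain ⟨K, hK, hflux⟩ := exists_flux_bounds (EuclideanSpace ℝ (Fin n)) (p := p) hM
  refine ⟨M / c * K, by positivity, ?_⟩
  intro σ₀ σ₁ A₀ A₁ hσ₀ hσ₁ hA₀ hA₁ hbσ₀ hbσ₁ hell₀ hell₁ u₀ u₁ hu₀ hu₁ hsol₀ hsol₁ hbdry
  set μ := volume.restrict Ω
  have hvol : volume Ω ≠ ⊤ := hΩbdd.measure_lt_top.ne
  have hmem : ∀ᵐ x ∂μ, x ∈ Ω := ae_restrict_mem hΩopen.measurableSet
  have hdiff : ∀ u : EuclideanSpace ℝ (Fin n) → ℝ, ContDiffOn ℝ 1 u (closure Ω) →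
      ∀ x ∈ Ω, DifferentiableAt ℝ u x := fun u hu x hx =>
    (hu.differentiableOn (by simp)).differentiableAt
      (Filter.mem_of_superset (hΩopen.mem_nhds hx) subset_closure)
  have hgrad : ∀ x ∈ Ω, gradient (fun y => u₁ y - u₀ y) x = gradient u₁ x - gradient u₀ x := by
    intro x hx
    rw [gradient, fderiv_fun_sub (hdiff u₁ hu₁ x hx) (hdiff u₀ hu₀ x hx), map_sub, gradient,
      gradient]
  obtain ⟨B₀, hB₀, hgB₀⟩ := hu₀.exists_norm_gradient_le hΩopen hΩbdd
  obtain ⟨B₁, hB₁, hgB₁⟩ := hu₁.exists_norm_gradient_le hΩopen hΩbdd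
  have hm₀ := measurable_gradient u₀
  have hm₁ := measurable_gradient u₁
  have htest : ∀ (σ : EuclideanSpace ℝ (Fin n) → ℝ)
      (A : EuclideanSpace ℝ (Fin n) → Matrix (Fin n) (Fin n) ℝ)
      (u : EuclideanSpace ℝ (Fin n) → ℝ), IsWeakSolution Ω p σ A u →
      ∫ x, σ x * |⟪matCLM (A x) (gradient u x), gradient u x⟫| ^ ((p - 2) / 2)
        * ⟪matCLM (A x) (gradient u x), gradient u₁ x - gradient u₀ x⟫ ∂μ = 0 := by
    intro σ A u hsol
    rw [← hsol (fun y => u₁ y - u₀ y) (hu₁.sub hu₀) fun x hx => by simp [hbdry x hx]]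
    refine setIntegral_congr_fun hΩopen.measurableSet fun x hx => ?_
    simp only [hgrad x hx]
  have hz₁ := htest σ₁ A₁ u₁ hsol₁
  have hz₀ := htest σ₀ A₀ u₀ hsol₀
  set g₀ := gradient u₀
  set g₁ := gradient u₁
  have hw : Measurable fun x => g₁ x - g₀ x := hm₁.sub hm₀
  have hE₀ : ∀ᵐ x ∂μ, IsEllipticForm M (matCLM (A₀ x)) := by
    filter_upwards [hell₀] with x hx
    exact ⟨inner_matCLM_comm hx.1, fun ξ => (hx.2 ξ).1, fun ξ => (hx.2 ξ).2⟩
  have hE₁ : ∀ᵐ x ∂μ, IsEllipticForm M (matCLM (A₁ x)) := by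
    filter_upwards [hell₁] with x hx
    exact ⟨inner_matCLM_comm hx.1, fun ξ => (hx.2 ξ).1, fun ξ => (hx.2 ξ).2⟩
  have habs : ∀ s : ℝ, 1 / M ≤ s ∧ s ≤ M → |s| ≤ M := fun s hs =>
    (abs_of_nonneg ((one_div_pos.2 hM).le.trans hs.1)).trans_le hs.2
  have hs₀ : ∀ᵐ x ∂μ, |σ₀ x| ≤ M := hbσ₀.mono fun x => habs _
  have hs₁ : ∀ᵐ x ∂μ, |σ₁ x| ≤ M := hbσ₁.mono fun x => habs _
  have hbw : ∀ᵐ x ∂μ, ‖g₁ x - g₀ x‖ ≤ B₀ + B₁ := by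
    filter_upwards [hmem] with x hx
    linarith [norm_sub_le (g₁ x) (g₀ x), hgB₀ x hx, hgB₁ x hx]
  have hbg₀ : ∀ᵐ x ∂μ, ‖g₀ x‖ ≤ B₀ + B₁ := hmem.mono fun x hx => by linarith [hgB₀ x hx]
  have hbg₁ : ∀ᵐ x ∂μ, ‖g₁ x‖ ≤ B₀ + B₁ := hmem.mono fun x hx => by linarith [hgB₁ x hx]
  obtain ⟨hint₀, hholder⟩ := integral_rpow_mul_le_lpNormVF hvol hp1 hm₀ hw hbg₀ hbw
  have hint₁ := (integral_rpow_mul_le_lpNormVF hvol hp1 hm₁ hw hbg₁ hbw).1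
  have hfint : ∀ (σ : EuclideanSpace ℝ (Fin n) → ℝ)
      (A : EuclideanSpace ℝ (Fin n) → Matrix (Fin n) (Fin n) ℝ)
      (g : EuclideanSpace ℝ (Fin n) → EuclideanSpace ℝ (Fin n)), Measurable σ →
      (∀ i j : Fin n, Measurable fun x => A x i j) → Measurable g →
      (∀ᵐ x ∂μ, |σ x| ≤ M) → (∀ᵐ x ∂μ, IsEllipticForm M (matCLM (A x))) →
      Integrable (fun x => ‖g x‖ ^ (p - 1) * ‖g₁ x - g₀ x‖) μ →
      Integrable (fun x => σ x * |⟪matCLM (A x) (g x), g x⟫| ^ ((p - 2) / 2)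
        * ⟪matCLM (A x) (g x), g₁ x - g₀ x⟫) μ := by
    intro σ A g hσ hA hg hs hE hint
    refine (hint.const_mul K).mono' ?_ ?_
    · exact ((hσ.mul ((measurable_inner_matCLM hA hg hg).norm.pow_const _)).mul
        (measurable_inner_matCLM hA hg hw)).aestronglyMeasurable
    · filter_upwards [hs, hE] with x hsx hEx
      exact (hflux _ _ _ _ hsx hsx hEx hEx _ _).1
  have hF₁₁ := hfint σ₁ A₁ g₁ hσ₁ hA₁ hm₁ hs₁ hE₁ hint₁
  have hF₁₀ := hfint σ₁ A₁ g₀ hσ₁ hA₁ hm₀ hs₁ hE₁ hint₀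
  have hF₀₀ := hfint σ₀ A₀ g₀ hσ₀ hA₀ hm₀ hs₀ hE₀ hint₀
  have hδσ : ∀ᵐ x ∂μ, |σ₁ x - σ₀ x| ≤ linftyNorm Ω (fun x => σ₁ x - σ₀ x) := by
    refine ae_le_essSup_of_ae_le (B := M + M) ?_
    filter_upwards [hs₀, hs₁] with x h₀ h₁
    exact (abs_sub _ _).trans (add_le_add h₁ h₀)
  have hδA : ∀ᵐ x ∂μ, ‖matCLM (A₁ x) - matCLM (A₀ x)‖ ≤
      linftyNormMat Ω (fun x => A₁ x - A₀ x) := by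
    simp only [linftyNormMat, matCLM_sub]
    refine ae_le_essSup_of_ae_le (B := M + M) ?_
    filter_upwards [hE₀, hE₁] with x h₀ h₁
    exact (norm_sub_le _ _).trans (add_le_add (h₁.norm_le hM) (h₀.norm_le hM))
  have hD : 0 ≤ linftyNorm Ω (fun x => σ₁ x - σ₀ x) + linftyNormMat Ω (fun x => A₁ x - A₀ x) :=
    add_nonneg (essSup_nonneg_of_nonneg _ fun _ => abs_nonneg _)
      (essSup_nonneg_of_nonneg _ fun _ => norm_nonneg _)
  set D := linftyNorm Ω (fun x => σ₁ x - σ₀ x) + linftyNormMat Ω (fun x => A₁ x - A₀ x)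
  have hupper := integral_mono_ae (hF₀₀.sub hF₁₀) (hint₀.const_mul (K * D)) <| by
    filter_upwards [hs₀, hs₁, hE₀, hE₁, hδσ, hδA] with x h₀ h₁ hT₀ hT₁ hσx hAx
    refine (hflux _ _ _ _ h₀ h₁ hT₀ hT₁ _ _).2.trans ?_
    have : |σ₁ x - σ₀ x| + ‖matCLM (A₁ x) - matCLM (A₀ x)‖ ≤ D := add_le_add hσx hAx
    gcongr
  have hlower := integral_mono_of_nonneg
    (f := fun x => c / M * ((‖g₁ x‖ + ‖g₀ x‖) ^ (p - 2) * ‖g₁ x - g₀ x‖ ^ 2))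
    (ae_of_all μ fun x => by simp only [Pi.zero_apply]; positivity) (hF₁₁.sub hF₁₀) <| by
    filter_upwards [hbσ₁, hE₁] with x hσx hT
    have hpos : 0 ≤ c * ((‖g₁ x‖ + ‖g₀ x‖) ^ (p - 2) * ‖g₁ x - g₀ x‖ ^ 2) := by positivity
    have h := mul_le_mul hσx.1 (hmono _ hT (g₁ x) (g₀ x)) hpos
      ((one_div_pos.2 hM).le.trans hσx.1)
    simp only [Pi.sub_apply]
    refine le_trans (le_of_eq ?_) (h.trans_eq ?_) <;> ring
  simp only [Pi.sub_apply] at hlower hupper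
  rw [integral_sub hF₁₁ hF₁₀, integral_const_mul, hz₁] at hlower
  rw [integral_sub hF₀₀ hF₁₀, integral_const_mul, hz₀] at hupper
  have hmain := (hlower.trans hupper).trans
    (mul_le_mul_of_nonneg_left hholder (mul_nonneg hK.le hD))
  have hscale := mul_le_mul_of_nonneg_left hmain (div_pos hM hc).le
  rw [← mul_assoc, div_mul_div_cancel₀ hc.ne', div_self hM.ne', one_mul] at hscale
  refine hscale.trans_eq ?_
  ring
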